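/- arXiv:1106.4623 — 2 statements merged into one kernel-verified Lean document; each statement's English description precedes it below -/
import Mathlib

section
/- Let D be the differential operator on smooth functions f(θ) defined by (Df)(θ) = cos²θ · f'(θ). For every odd positive integer k and smooth f, one has (1/cos^k θ) · d/dθ ( D^k ( f(θ)/cos^k θ ) ) = (d²/dθ² + k²)(d²/dθ² + (k-2)²)···(d²/dθ² + 9)(d²/dθ² + 1) f(θ). -/
open Real

/-- The operator `D : f ↦ cos²θ · f'`. -/
noncomputable def Dop (f : ℝ → ℝ) : ℝ → ℝ := fun θ => Real.cos θ ^ 2 * deriv f θ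

/-- `oddOp t f = (d²/dθ² + (2t+1)²) ⋯ (d²/dθ² + 9)(d²/dθ² + 1) f`,
the composition of the operators `d²/dθ² + m²` over odd `m` with `1 ≤ m ≤ 2t+1`. -/
noncomputable def oddOp : ℕ → (ℝ → ℝ) → (ℝ → ℝ)
  | 0, f => fun θ => deriv (deriv f) θ + f θ
  | t + 1, f => fun θ =>
      deriv (deriv (oddOp t f)) θ + ((2 * t + 3 : ℕ) : ℝ) ^ 2 * oddOp t f θ

theorem cos_ne_zero_of_mem {θ : ℝ} (hθ : θ ∈ Set.Ioo (-(π / 2)) (π / 2)) : Real.cos θ ≠ 0 :=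
  (Real.cos_pos_of_mem_Ioo hθ).ne'

theorem HasDerivAt.Dop_eq {u : ℝ → ℝ} {u' θ : ℝ} (h : HasDerivAt u u' θ) :
    Dop u θ = Real.cos θ ^ 2 * u' := by
  rw [Dop, h.deriv]

theorem Dop_congr {s : Set ℝ} (hs : IsOpen s) {u v : ℝ → ℝ} (h : Set.EqOn u v s) :
    Set.EqOn (Dop u) (Dop v) s := by
  intro θ hθ
  simp only [Dop, (h.eventuallyEq_of_mem (hs.mem_nhds hθ)).deriv_eq]

theorem ContDiffOn.Dop {s : Set ℝ} (hs : IsOpen s) {u : ℝ → ℝ}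
    (hu : ContDiffOn ℝ (⊤ : ℕ∞) u s) : ContDiffOn ℝ (⊤ : ℕ∞) (Dop u) s :=
  (Real.contDiff_cos.pow 2).contDiffOn.mul (hu.deriv_of_isOpen hs (by simp))

theorem ContDiffOn.Dop_iterate {s : Set ℝ} (hs : IsOpen s) {u : ℝ → ℝ}
    (hu : ContDiffOn ℝ (⊤ : ℕ∞) u s) (m : ℕ) : ContDiffOn ℝ (⊤ : ℕ∞) (_root_.Dop^[m] u) s := by
  induction m with
  | zero => exact hu
  | succ m ih =>
    rw [Function.iterate_succ_apply']
    exact ih.Dop hs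

theorem ContDiffOn.hasDerivAt_Dop_div {s : Set ℝ} (hs : IsOpen s) {u : ℝ → ℝ}
    (hu : ContDiffOn ℝ (⊤ : ℕ∞) u s) {θ : ℝ} (hθ : θ ∈ s) (hc : Real.cos θ ≠ 0) :
    HasDerivAt u (_root_.Dop u θ / Real.cos θ ^ 2) θ := by
  have h := ((hu.contDiffAt (hs.mem_nhds hθ)).differentiableAt (by simp)).hasDerivAt
  refine h.congr_deriv ?_
  simp only [_root_.Dop]
  field_simp

theorem hasDerivAt_inv_cos_sq {θ : ℝ} (hc : Real.cos θ ≠ 0) :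
    HasDerivAt (fun x => 1 / Real.cos x ^ 2) (2 * Real.tan θ / Real.cos θ ^ 2) θ := by
  have h := ((Real.hasDerivAt_cos θ).fun_pow 2).fun_inv (pow_ne_zero 2 hc)
  simp only [one_div]
  refine h.congr_deriv ?_
  rw [Real.tan_eq_sin_div_cos]
  field_simp
  norm_num
  ring

/-- The Leibniz rule for `D^(m+2)`, which is differentiation with respect to `tan θ`, applied to a
product with `1 / cos² θ = 1 + tan² θ`. -/
theorem Dop_iterate_div_cos_sq {g : ℝ → ℝ}
    (hg : ContDiffOn ℝ (⊤ : ℕ∞) g (Set.Ioo (-(π / 2)) (π / 2))) (m : ℕ) :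
    Set.EqOn (Dop^[m + 2] (fun x => g x / Real.cos x ^ 2))
      (fun x => 1 / Real.cos x ^ 2 * Dop^[m + 2] g x
        + (2 * (m + 2) : ℝ) * (Real.tan x * Dop^[m + 1] g x)
        + ((m + 2) * (m + 1) : ℝ) * Dop^[m] g x) (Set.Ioo (-(π / 2)) (π / 2)) := by
  have hd (n : ℕ) {θ : ℝ} (hθ : θ ∈ Set.Ioo (-(π / 2)) (π / 2)) :
      HasDerivAt (Dop^[n] g) (Dop^[n + 1] g θ / Real.cos θ ^ 2) θ := by
    rw [Function.iterate_succ_apply']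
    exact (hg.Dop_iterate isOpen_Ioo n).hasDerivAt_Dop_div isOpen_Ioo hθ (cos_ne_zero_of_mem hθ)
  induction m with
  | zero =>
    have h1 : Set.EqOn (Dop (fun x => g x / Real.cos x ^ 2))
        (fun x => 1 / Real.cos x ^ 2 * Dop^[1] g x + 2 * (Real.tan x * Dop^[0] g x))
        (Set.Ioo (-(π / 2)) (π / 2)) := by
      intro θ hθ
      have hc := cos_ne_zero_of_mem hθ
      have h := (hasDerivAt_inv_cos_sq hc).fun_mul (hd 0 hθ)
      have e : (fun x => g x / Real.cos x ^ 2) = fun x => 1 / Real.cos x ^ 2 * Dop^[0] g x := by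
        funext x
        simp only [Function.iterate_zero, id]
        ring
      rw [e, h.Dop_eq]
      field_simp
      ring
    intro θ hθ
    have hc := cos_ne_zero_of_mem hθ
    have h := ((hasDerivAt_inv_cos_sq hc).fun_mul (hd 1 hθ)).fun_add
      (((Real.hasDerivAt_tan hc).fun_mul (hd 0 hθ)).const_mul 2)
    refine (Dop_congr isOpen_Ioo h1 hθ).trans ?_
    rw [h.Dop_eq]
    push_cast
    simp only [zero_add]
    field_simp
    ring
  | succ m ih =>
    intro θ hθ
    have hc := cos_ne_zero_of_mem hθ
    have h := (((hasDerivAt_inv_cos_sq hc).fun_mul (hd (m + 2) hθ)).fun_add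
      (((Real.hasDerivAt_tan hc).fun_mul (hd (m + 1) hθ)).const_mul (2 * (m + 2) : ℝ))).fun_add
      ((hd m hθ).const_mul ((m + 2) * (m + 1) : ℝ))
    rw [show m + 1 + 2 = m + 2 + 1 by ring, Function.iterate_succ_apply']
    refine (Dop_congr isOpen_Ioo ih hθ).trans ?_
    rw [h.Dop_eq]
    push_cast
    simp only [show m + 1 + 1 = m + 2 from rfl]
    field_simp
    ring

theorem contDiff_deriv {u : ℝ → ℝ} (hu : ContDiff ℝ (⊤ : ℕ∞) u) :
    ContDiff ℝ (⊤ : ℕ∞) (deriv u) :=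
  (contDiff_infty_iff_deriv.1 hu).2

theorem contDiff_oddOp (t : ℕ) {f : ℝ → ℝ} (hf : ContDiff ℝ (⊤ : ℕ∞) f) :
    ContDiff ℝ (⊤ : ℕ∞) (oddOp t f) := by
  induction t with
  | zero => exact (contDiff_deriv (contDiff_deriv hf)).add hf
  | succ t ih => exact (contDiff_deriv (contDiff_deriv ih)).add (contDiff_const.mul ih)

theorem Dop_cos_pow_mul {F : ℝ → ℝ} (hF : Differentiable ℝ F) (n : ℕ) :
    Dop (fun x => Real.cos x ^ (n + 1) * F x) = fun x =>
      Real.cos x ^ (n + 3) * deriv F x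
        - (n + 1) * (Real.cos x ^ (n + 2) * (Real.sin x * F x)) := by
  funext θ
  have h := ((Real.hasDerivAt_cos θ).fun_pow (n + 1)).fun_mul (hF θ).hasDerivAt
  rw [h.Dop_eq]
  push_cast
  ring

theorem Dop_Dop_cos_pow_mul {F : ℝ → ℝ} (hF : ContDiff ℝ (⊤ : ℕ∞) F) (n : ℕ) (θ : ℝ) :
    Dop (Dop (fun x => Real.cos x ^ (n + 1) * F x)) θ =
      Real.cos θ ^ (n + 5) * deriv (deriv F) θ
        - (2 * n + 4) * (Real.cos θ ^ (n + 4) * Real.sin θ * deriv F θ)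
        + (n + 1) * ((n + 2) * Real.sin θ ^ 2 - Real.cos θ ^ 2) * Real.cos θ ^ (n + 3) * F θ := by
  rw [Dop_cos_pow_mul (hF.differentiable (by simp))]
  have hF0 := ((hF.differentiable (by simp)) θ).hasDerivAt
  have hF1 := (((contDiff_deriv hF).differentiable (by simp)) θ).hasDerivAt
  have h := (((Real.hasDerivAt_cos θ).fun_pow (n + 3)).fun_mul hF1).fun_sub
    ((((Real.hasDerivAt_cos θ).fun_pow (n + 2)).fun_mul
      ((Real.hasDerivAt_sin θ).fun_mul hF0)).const_mul (n + 1 : ℝ))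
  rw [h.Dop_eq]
  push_cast
  ring

theorem contDiffOn_div_cos_pow {f : ℝ → ℝ} (hf : ContDiff ℝ (⊤ : ℕ∞) f) (k : ℕ) :
    ContDiffOn ℝ (⊤ : ℕ∞) (fun x => f x / Real.cos x ^ k) (Set.Ioo (-(π / 2)) (π / 2)) :=
  hf.contDiffOn.div (Real.contDiff_cos.pow k).contDiffOn
    fun _ hx => pow_ne_zero k (cos_ne_zero_of_mem hx)

theorem Dop_iterate_div_cos_pow {f : ℝ → ℝ} (hf : ContDiff ℝ (⊤ : ℕ∞) f) (t : ℕ) :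
    Set.EqOn (Dop^[2 * t + 2] (fun x => f x / Real.cos x ^ (2 * t + 1)))
      (fun x => Real.cos x ^ (2 * t + 3) * oddOp t f x) (Set.Ioo (-(π / 2)) (π / 2)) := by
  induction t with
  | zero =>
    have h1 : Set.EqOn (Dop (fun x => f x / Real.cos x ^ 1))
        (fun x => Real.cos x * deriv f x + Real.sin x * f x) (Set.Ioo (-(π / 2)) (π / 2)) := by
      intro θ hθ
      have hc := cos_ne_zero_of_mem hθ
      have h := ((hf.differentiable (by simp)) θ).hasDerivAt.fun_div (Real.hasDerivAt_cos θ) hc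
      simp only [pow_one]
      rw [h.Dop_eq]
      field_simp
      ring
    intro θ hθ
    have hF0 := ((hf.differentiable (by simp)) θ).hasDerivAt
    have hF1 := (((contDiff_deriv hf).differentiable (by simp)) θ).hasDerivAt
    have h := ((Real.hasDerivAt_cos θ).fun_mul hF1).fun_add ((Real.hasDerivAt_sin θ).fun_mul hF0)
    refine (Dop_congr isOpen_Ioo h1 hθ).trans ?_
    rw [h.Dop_eq]
    simp only [oddOp]
    ring
  | succ t ih =>
    intro θ hθ
    have hc := cos_ne_zero_of_mem hθ
    have e : (fun x => f x / Real.cos x ^ (2 * (t + 1) + 1)) =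
        fun x => f x / Real.cos x ^ (2 * t + 1) / Real.cos x ^ 2 := by
      funext x
      rw [div_div, ← pow_add]
      ring_nf
    have i1 := Dop_congr isOpen_Ioo ih
    have i2 := Dop_congr isOpen_Ioo i1
    have hF := contDiff_oddOp t hf
    rw [e]
    refine (Dop_iterate_div_cos_sq (contDiffOn_div_cos_pow hf _) (2 * t + 2) hθ).trans ?_
    simp only [Function.iterate_succ_apply' Dop (2 * t + 2 + 1),
      Function.iterate_succ_apply' Dop (2 * t + 2)]
    rw [i2 hθ, i1 hθ, ih hθ, Dop_Dop_cos_pow_mul hF (2 * t + 2),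
      Dop_cos_pow_mul (hF.differentiable (by simp)) (2 * t + 2)]
    simp only [oddOp, Real.tan_eq_sin_div_cos]
    have hs : Real.sin θ ^ 2 = 1 - Real.cos θ ^ 2 := Real.sin_sq θ
    push_cast
    field_simp
    ring_nf
    simp only [hs]
    ring

/-- For every odd positive `k = 2t+1` and every smooth `f`, on `(-π/2, π/2)` one has
`(1/cos^k θ) · d/dθ (D^k (f/cos^k)) = (d²/dθ²+k²)⋯(d²/dθ²+9)(d²/dθ²+1) f`. -/
theorem oddCaseLemma (k t : ℕ) (hk : k = 2 * t + 1)
    (f : ℝ → ℝ) (hf : ContDiff ℝ (⊤ : ℕ∞) f)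
    (θ : ℝ) (hθ : θ ∈ Set.Ioo (-(π / 2)) (π / 2)) :
    (1 / Real.cos θ ^ k) * deriv (Dop^[k] (fun x => f x / Real.cos x ^ k)) θ
      = oddOp t f θ := by
  subst hk
  have hc := cos_ne_zero_of_mem hθ
  have h := Dop_iterate_div_cos_pow hf t hθ
  rw [Function.iterate_succ_apply'] at h
  simp only [Dop] at h
  have h' : deriv (Dop^[2 * t + 1] (fun x => f x / Real.cos x ^ (2 * t + 1))) θ
      = Real.cos θ ^ (2 * t + 1) * oddOp t f θ := by
    apply mul_left_cancel₀ (pow_ne_zero 2 hc)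
    refine h.trans ?_
    ring
  rw [h']
  field_simp
end

section
/- Let ∇ = d/dθ and Υ be multiplication by tan θ on smooth functions on (-π/2, π/2). For every odd k ≥ 1, the composition (∇ − kΥ)(∇ − (k−2)Υ)···(∇ + (k−2)Υ)(∇ + kΥ) over odd integers from −k to k equals (∇² + k²)(∇² + (k−2)²)···(∇² + 9)(∇² + 1) as operators. -/
open Real

/-- The factor `∇ + jΥ : g ↦ g' + j tan θ · g`. -/
noncomputable def factorOp (j : ℤ) (g : ℝ → ℝ) : ℝ → ℝ := fun θ =>
  deriv g θ + (j : ℝ) * Real.tan θ * g θ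

/-- The composition `∏ (∇ + jΥ)` over the entries of `l`, the head of the list
being the outermost factor. -/
noncomputable def prodFactorOp (l : List ℤ) (f : ℝ → ℝ) : ℝ → ℝ := l.foldr factorOp f

open Set in
theorem contDiffOn_tan_Ioo : ContDiffOn ℝ (⊤ : ℕ∞) Real.tan (Ioo (-(π / 2)) (π / 2)) := fun _ hx =>
  (Real.contDiffAt_tan.2 (Real.cos_pos_of_mem_Ioo hx).ne').contDiffWithinAt

/-- On `(-π/2, π/2)`, the factor `∇ + jΥ` preserves smoothness. -/
theorem contDiffOn_factorOp {g : ℝ → ℝ} (j : ℤ)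
    (hg : ContDiffOn ℝ (⊤ : ℕ∞) g (Set.Ioo (-(π / 2)) (π / 2))) :
    ContDiffOn ℝ (⊤ : ℕ∞) (factorOp j g) (Set.Ioo (-(π / 2)) (π / 2)) :=
  (hg.deriv_of_isOpen isOpen_Ioo (by simp)).add
    ((contDiffOn_const.mul contDiffOn_tan_Ioo).mul hg)

/-- `factorChain k m` is `(∇ + (k - 2m + 2)Υ) ⋯ (∇ + (k - 2)Υ)(∇ + kΥ)`, with `m` factors. -/
noncomputable def factorChain (k : ℤ) : ℕ → (ℝ → ℝ) → (ℝ → ℝ)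
  | 0, f => f
  | m + 1, f => factorOp (k - 2 * m) (factorChain k m f)

theorem contDiffOn_factorChain {f : ℝ → ℝ} (k : ℤ) (m : ℕ)
    (hf : ContDiffOn ℝ (⊤ : ℕ∞) f (Set.Ioo (-(π / 2)) (π / 2))) :
    ContDiffOn ℝ (⊤ : ℕ∞) (factorChain k m f) (Set.Ioo (-(π / 2)) (π / 2)) := by
  induction m with
  | zero => exact hf
  | succ m ih => exact contDiffOn_factorOp _ ih

theorem prodFactorOp_map_range (n : ℕ) (a : ℤ) (f : ℝ → ℝ) :
    prodFactorOp ((List.range n).map (fun i : ℕ => a + 2 * (i : ℤ))) f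
      = factorChain (a + 2 * n - 2) n f := by
  induction n generalizing a with
  | zero => rfl
  | succ n ih =>
    have htail : (List.range n).map ((fun i : ℕ => a + 2 * (i : ℤ)) ∘ Nat.succ)
        = (List.range n).map (fun i : ℕ => (a + 2) + 2 * (i : ℤ)) := by
      congr 1; funext i; simp; ring
    rw [List.range_succ_eq_map, List.map_cons, List.map_map, htail]
    change factorOp _ (prodFactorOp _ f) = factorOp _ _
    rw [ih, show a + 2 + 2 * (n : ℤ) - 2 = a + 2 * ((n + 1 : ℕ) : ℤ) - 2 by push_cast; ring]
    congr 1
    push_cast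
    ring

theorem hasDerivAt_factorChain {f : ℝ → ℝ}
    (hf : ContDiffOn ℝ (⊤ : ℕ∞) f (Set.Ioo (-(π / 2)) (π / 2))) (k : ℤ) (m : ℕ)
    {θ : ℝ} (hθ : θ ∈ Set.Ioo (-(π / 2)) (π / 2)) :
    HasDerivAt (factorChain k m f)
      (factorChain k (m + 1) f θ - (k - 2 * m) * Real.tan θ * factorChain k m f θ) θ := by
  have h := (((contDiffOn_factorChain k m hf).differentiableOn (by simp)).differentiableAt
    (isOpen_Ioo.mem_nhds hθ)).hasDerivAt
  refine h.congr_deriv ?_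
  change _ = factorOp (k - 2 * m) (factorChain k m f) θ - _
  rw [factorOp]
  push_cast
  ring

theorem hasDerivAt_tan_Ioo {θ : ℝ} (hθ : θ ∈ Set.Ioo (-(π / 2)) (π / 2)) :
    HasDerivAt Real.tan (1 + Real.tan θ ^ 2) θ := by
  have hc := (Real.cos_pos_of_mem_Ioo hθ).ne'
  refine (Real.hasDerivAt_tan hc).congr_deriv ?_
  rw [← Real.inv_one_add_tan_sq hc, one_div, inv_inv]

/-- Conjugated form of the Leibniz rule for `(d/du)^m ((1 + u²) h)` with `u = tan θ`. -/
theorem factorChain_leibniz {f : ℝ → ℝ}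
    (hf : ContDiffOn ℝ (⊤ : ℕ∞) f (Set.Ioo (-(π / 2)) (π / 2))) (k : ℤ) (m : ℕ) :
    Set.EqOn (factorChain (k + 2) (m + 2) f)
      (fun θ => factorChain k (m + 2) f θ + 2 * (m + 2) * Real.tan θ * factorChain k (m + 1) f θ
        + (m + 2) * (m + 1) * (1 + Real.tan θ ^ 2) * factorChain k m f θ)
      (Set.Ioo (-(π / 2)) (π / 2)) := by
  induction m with
  | zero =>
    intro θ hθ
    have h0 := hasDerivAt_factorChain hf k 0 hθ
    have h1 := hasDerivAt_factorChain hf k 1 hθ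
    have ht := hasDerivAt_tan_Ioo hθ
    have hE : Set.EqOn (factorChain (k + 2) 1 f)
        (fun θ => factorChain k 1 f θ + 2 * Real.tan θ * factorChain k 0 f θ)
        (Set.Ioo (-(π / 2)) (π / 2)) := by
      intro x _
      simp only [factorChain, factorOp]
      push_cast
      ring
    have hd := ((h1.add ((ht.const_mul 2).mul h0)).congr_of_eventuallyEq
      (hE.eventuallyEq_of_mem (isOpen_Ioo.mem_nhds hθ))).deriv
    change deriv (factorChain (k + 2) 1 f) θ + _ * _ * factorChain (k + 2) 1 f θ = _
    rw [hd, hE hθ]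
    push_cast
    ring
  | succ m ih =>
    intro θ hθ
    have h0 := hasDerivAt_factorChain hf k m hθ
    have h1 := hasDerivAt_factorChain hf k (m + 1) hθ
    have h2 := hasDerivAt_factorChain hf k (m + 2) hθ
    have ht := hasDerivAt_tan_Ioo hθ
    have hd := (((h2.add ((ht.const_mul (2 * ((m : ℝ) + 2))).mul h1)).add
      ((((ht.pow 2).const_add 1).const_mul (((m : ℝ) + 2) * (m + 1))).mul h0)).congr_of_eventuallyEq
      (ih.eventuallyEq_of_mem (isOpen_Ioo.mem_nhds hθ))).deriv
    change deriv (factorChain (k + 2) (m + 2) f) θ + _ * _ * factorChain (k + 2) (m + 2) f θ = _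
    rw [hd, ih hθ, Pi.pow_apply]
    push_cast
    ring

/-- Enlarging the symmetric product by the factors `∇ ∓ (n + 1)Υ` on both ends amounts to composing
with `∇² + (n + 1)²`. -/
theorem factorChain_symm_succ {f : ℝ → ℝ}
    (hf : ContDiffOn ℝ (⊤ : ℕ∞) f (Set.Ioo (-(π / 2)) (π / 2))) (n : ℕ)
    {θ : ℝ} (hθ : θ ∈ Set.Ioo (-(π / 2)) (π / 2)) :
    factorChain (n + 1) (n + 2) f θ = deriv (deriv (factorChain (n - 1) n f)) θ
      + ((n : ℝ) + 1) ^ 2 * factorChain (n - 1) n f θ := by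
  have h0 := hasDerivAt_factorChain hf (n - 1) n hθ
  have h1 := hasDerivAt_factorChain hf (n - 1) (n + 1) hθ
  have ht := hasDerivAt_tan_Ioo hθ
  have hE : Set.EqOn (deriv (factorChain (n - 1) n f))
      (fun x => factorChain (n - 1) (n + 1) f x
        - (((n - 1 : ℤ) : ℝ) - 2 * n) * Real.tan x * factorChain (n - 1) n f x)
      (Set.Ioo (-(π / 2)) (π / 2)) := fun x hx => (hasDerivAt_factorChain hf (n - 1) n hx).deriv
  have hd := ((h1.sub ((ht.const_mul (((n - 1 : ℤ) : ℝ) - 2 * n)).mul h0)).congr_of_eventuallyEq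
    (hE.eventuallyEq_of_mem (isOpen_Ioo.mem_nhds hθ))).deriv
  have hL := factorChain_leibniz hf (n - 1) n hθ
  rw [show (n - 1 : ℤ) + 2 = n + 1 by ring] at hL
  rw [hL, hd]
  push_cast
  ring

theorem factorChain_eqOn_oddOp {f : ℝ → ℝ}
    (hf : ContDiffOn ℝ (⊤ : ℕ∞) f (Set.Ioo (-(π / 2)) (π / 2))) (t : ℕ) :
    Set.EqOn (factorChain (2 * t + 1) (2 * t + 2) f) (oddOp t f)
      (Set.Ioo (-(π / 2)) (π / 2)) := by
  induction t with
  | zero =>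
    intro θ hθ
    simpa [factorChain, oddOp] using factorChain_symm_succ hf 0 hθ
  | succ t ih =>
    intro θ hθ
    have h := factorChain_symm_succ hf (2 * t + 2) hθ
    push_cast at h ⊢
    rw [show (2 * t + 2 - 1 : ℤ) = 2 * t + 1 by ring, ih hθ,
      (ih.eventuallyEq_of_mem (isOpen_Ioo.mem_nhds hθ)).deriv.deriv_eq] at h
    rw [show (2 * (t + 1) + 1 : ℤ) = 2 * t + 2 + 1 by ring,
      show 2 * (t + 1) + 2 = 2 * t + 2 + 2 by ring, h, oddOp]
    push_cast
    ring

/-- For odd `k = 2t+1`, the composition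
`(∇ − kΥ)(∇ − (k−2)Υ)⋯(∇ + (k−2)Υ)(∇ + kΥ)` over odd `j` from `−k` to `k`
(with `∇ + kΥ` innermost) equals `(∇² + k²)⋯(∇² + 9)(∇² + 1)`, as operators on
smooth functions on `(-π/2, π/2)`. -/
theorem odd_product_identity (k t : ℕ) (hk : k = 2 * t + 1)
    (f : ℝ → ℝ) (hf : ContDiff ℝ (⊤ : ℕ∞) f)
    (θ : ℝ) (hθ : θ ∈ Set.Ioo (-(π / 2)) (π / 2)) :
    prodFactorOp ((List.range (2 * t + 2)).map (fun i => -(k : ℤ) + 2 * i)) f θ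
      = oddOp t f θ := by
  have hlist : (List.range (2 * t + 2)).map (fun i => -(k : ℤ) + 2 * i)
      = (List.range (2 * t + 2)).map (fun i : ℕ => -(k : ℤ) + 2 * (i : ℤ)) := by
    rw [show (do let i ← List.range (2 * t + 2); pure (i : ℤ) : List ℤ)
      = (List.range (2 * t + 2)).map (fun i : ℕ => (i : ℤ)) from List.flatMap_pure_eq_map _ _,
      List.map_map]
    rfl
  rw [hlist, prodFactorOp_map_range, ← factorChain_eqOn_oddOp hf.contDiffOn t hθ]
  congr 1
  subst hk
  push_cast
  ring_nf
end
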